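/- Radial upper spreading bound from directional bounds (Theorem 2.3(3), nonlocal dispersal case). Assume f satisfies (H0). Let c > 0 and suppose that for every unit vector ξ ∈ ℝ^N and every v₀ ∈ X⁺(ξ), every solution v of (E_f) on [0,∞) with v(0,·) = v₀ satisfies sup{ v(t,x) : x·ξ ≥ ct } → 0 as t → ∞. Then for every u₀ ∈ X with u₀ ≥ 0 which vanishes outside a bounded subset of ℝ^N, every solution u of (E_f) on [0,∞) with u(0,·) = u₀, and every c' > c, one has sup{ u(t,x) : ‖x‖ ≥ c't } → 0 as t → ∞. -/

import Mathlib

open MeasureTheory Set Filter RealInnerProductSpace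

noncomputable section

abbrev Euc (N : ℕ) := EuclideanSpace ℝ (Fin N)

/-- Membership in `X`: bounded and uniformly continuous real functions on `ℝ^N`. -/
def MemX {N : ℕ} (u : Euc N → ℝ) : Prop :=
  UniformContinuous u ∧ ∃ C, ∀ x, |u x| ≤ C

/-- Hypotheses on the convolution kernel `κ`. -/
def KernelHyp {N : ℕ} (κ : Euc N → ℝ) : Prop :=
  Continuous κ ∧ (∀ z, 0 ≤ κ z) ∧ HasCompactSupport κ ∧ 0 < κ 0 ∧ (∫ z, κ z) = 1

/-- Hypothesis (H0) on the nonlinearity `f`. -/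
def SatH0 {N : ℕ} (T M₀ : ℝ) (f : ℝ → Euc N → ℝ → ℝ) : Prop :=
  (∀ t x u, f (t + T) x u = f t x u) ∧
  (∀ x : Euc N, ContDiff ℝ 1 (fun p : ℝ × ℝ => f p.1 x p.2)) ∧
  (∀ R : ℝ, 0 < R →
    (∃ C, ∀ t x u, |u| ≤ R →
      |f t x u| + |deriv (fun s => f s x u) t| + |deriv (fun v => f t x v) u| ≤ C) ∧
    UniformContinuousOn (fun p : ℝ × Euc N × ℝ => f p.1 p.2.1 p.2.2)
      {p : ℝ × Euc N × ℝ | |p.2.2| ≤ R} ∧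
    UniformContinuousOn (fun p : ℝ × Euc N × ℝ => deriv (fun s => f s p.2.1 p.2.2) p.1)
      {p : ℝ × Euc N × ℝ | |p.2.2| ≤ R} ∧
    UniformContinuousOn (fun p : ℝ × Euc N × ℝ => deriv (fun v => f p.1 p.2.1 v) p.2.2)
      {p : ℝ × Euc N × ℝ | |p.2.2| ≤ R}) ∧
  (∀ t x u, M₀ ≤ u → f t x u < 0) ∧
  (∀ a b : ℝ, 0 ≤ a → a ≤ b → ∃ c < (0:ℝ), ∀ t x u, a ≤ u → u ≤ b →
    deriv (fun v => f t x v) u ≤ c)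

/-- Right-hand side of the nonlocal dispersal KPP equation (E_g). -/
def RHS {N : ℕ} (κ : Euc N → ℝ) (g : ℝ → Euc N → ℝ → ℝ)
    (u : ℝ → Euc N → ℝ) (t : ℝ) (x : Euc N) : ℝ :=
  (∫ y, κ (y - x) * u t y) - u t x + u t x * g t x (u t x)

/-- A solution of (E_g) on the interval `I`. -/
def IsSol {N : ℕ} (κ : Euc N → ℝ) (g : ℝ → Euc N → ℝ → ℝ)
    (u : ℝ → Euc N → ℝ) (I : Set ℝ) : Prop :=
  ContinuousOn (fun p : ℝ × Euc N => u p.1 p.2) (I ×ˢ univ) ∧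
  (∀ t ∈ I, MemX (u t)) ∧
  (∀ J : Set ℝ, J ⊆ I → IsCompact J → ∃ C, ∀ t ∈ J, ∀ x, |u t x| ≤ C) ∧
  (∀ x : Euc N, ∀ t ∈ interior I, HasDerivAt (fun s => u s x) (RHS κ g u t x) t)

/-- A time periodic strictly positive solution of (E_g). -/
def PeriodicPosSol {N : ℕ} (κ : Euc N → ℝ) (g : ℝ → Euc N → ℝ → ℝ) (T : ℝ)
    (u : ℝ → Euc N → ℝ) : Prop :=
  IsSol κ g u univ ∧ (∀ t x, u (t + T) x = u t x) ∧ ∃ δ > 0, ∀ t x, δ ≤ u t x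

/-- The part metric between two strictly positive bounded functions. -/
def PartMetric {N : ℕ} (u v : Euc N → ℝ) : ℝ :=
  sInf (Real.log '' {α : ℝ | 1 ≤ α ∧ ∀ x, u x / α ≤ v x ∧ v x ≤ α * u x})

/-- Hypothesis (H1): `f` is asymptotically (in space) equal to the time and space
periodic nonlinearity `f₀`. -/
def SatH1 {N : ℕ} (T M₀ : ℝ) (p : Fin N → ℝ) (f f₀ : ℝ → Euc N → ℝ → ℝ) : Prop :=
  SatH0 T M₀ f₀ ∧ (∀ i, 0 < p i) ∧
  (∀ i t x u, f₀ t (x + p i • EuclideanSpace.single i (1:ℝ)) u = f₀ t x u) ∧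
  (∀ R : ℝ, 0 < R → ∀ ε : ℝ, 0 < ε → ∃ ρ : ℝ, ∀ t x u, ρ ≤ ‖x‖ → |u| ≤ R →
    |f t x u - f₀ t x u| ≤ ε)

/-- A time and space periodic positive solution of (E_g) (period `T` in time and
periods `pᵢ` in the spatial coordinate directions). -/
def PeriodicMediaSol {N : ℕ} (κ : Euc N → ℝ) (g : ℝ → Euc N → ℝ → ℝ) (T : ℝ)
    (p : Fin N → ℝ) (u : ℝ → Euc N → ℝ) : Prop :=
  IsSol κ g u univ ∧ (∀ t x, u (t + T) x = u t x) ∧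
  (∀ i t x, u t (x + p i • EuclideanSpace.single i (1:ℝ)) = u t x) ∧
  (∀ t x, 0 < u t x)

/-- The class `X⁺(ξ)` of front-like nonnegative initial data in the direction `ξ`. -/
def XplusXi {N : ℕ} (ξ : Euc N) (u : Euc N → ℝ) : Prop :=
  MemX u ∧ (∀ x, 0 ≤ u x) ∧
  (∃ m > 0, ∃ r : ℝ, ∀ x, ⟪x, ξ⟫ ≤ r → m ≤ u x) ∧
  (∃ r₀ : ℝ, ∀ x, r₀ ≤ ⟪x, ξ⟫ → u x = 0)



lemma exp_int_bound {Y : Type*} [NormedAddCommGroup Y] [NormedSpace ℝ Y]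
    (lam : ℝ) (hl : 0 < lam) (B : ℝ) (hB : 0 ≤ B) (h : ℝ → Y) (a : ℝ) (ha : 0 ≤ a)
    (hh : ∀ s, 0 ≤ s → ‖h s‖ ≤ B * Real.exp (lam * s)) :
    Real.exp (-(lam * a)) * ‖∫ s in (0:ℝ)..a, h s‖ ≤ B / lam := by
  have h1 : ‖∫ s in (0:ℝ)..a, h s‖ ≤ ∫ s in (0:ℝ)..a, B * Real.exp (lam * s) := by
    apply intervalIntegral.norm_integral_le_of_norm_le ha
    · filter_upwards with s hs using hh s hs.1.le
    · apply Continuous.intervalIntegrable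
      fun_prop
  have h2 : ∫ s in (0:ℝ)..a, B * Real.exp (lam * s) = B * ((Real.exp (lam * a) - 1) / lam) := by
    rw [intervalIntegral.integral_const_mul, intervalIntegral.integral_comp_mul_left _ hl.ne']
    simp; left; field_simp
  rw [h2] at h1
  calc _ ≤ Real.exp (-(lam * a)) * (B * ((Real.exp (lam * a) - 1) / lam)) := by gcongr
    _ = B / lam * (1 - Real.exp (-(lam * a))) := by
      rw [Real.exp_neg]; field_simp
    _ ≤ B / lam * 1 := by
      gcongr
      linarith [Real.exp_pos (-(lam * a))]
    _ = _ := mul_one _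

lemma global_ode {Y : Type*} [NormedAddCommGroup Y] [NormedSpace ℝ Y] [CompleteSpace Y]
    (G : ℝ → Y → Y) (L : ℝ) (hL0 : 0 ≤ L) (hL : ∀ t y z, ‖G t y - G t z‖ ≤ L * ‖y - z‖)
    (C : ℝ) (hC : ∀ t, ‖G t 0‖ ≤ C) (hG : ∀ y, Continuous fun t => G t y) (v0 : Y) :
    ∃ v : ℝ → Y, Continuous v ∧ v 0 = v0 ∧ ∀ t > 0, HasDerivAt v (G t (v t)) t := by
  have hC0 : 0 ≤ C := (norm_nonneg _).trans (hC 0)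
  have hjoint : Continuous (fun p : ℝ × Y => G p.1 p.2) := by
    apply continuous_prod_of_continuous_lipschitzWith' (fun p : ℝ × Y => G p.1 p.2) ⟨L, hL0⟩
    · intro t
      apply LipschitzWith.of_dist_le_mul
      intro y z
      rw [dist_eq_norm, dist_eq_norm]
      exact hL t y z
    · exact hG
  set lam : ℝ := 2 * L + 1 with hlam
  have hl : 0 < lam := by positivity
  let g : BoundedContinuousFunction ℝ Y → ℝ → Y := fun w s => G s (Real.exp (lam * s) • w s)
  have hgc : ∀ w, Continuous (g w) := by
    intro w
    apply hjoint.comp (f := fun s => (s, Real.exp (lam * s) • w s))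
    fun_prop
  have hgb : ∀ w s, 0 ≤ s → ‖g w s‖ ≤ (C + L * ‖w‖) * Real.exp (lam * s) := by
    intro w s hs
    have h1 := hL s (Real.exp (lam * s) • w s) 0
    have h2 : ‖g w s‖ ≤ ‖G s (Real.exp (lam * s) • w s) - G s 0‖ + ‖G s 0‖ := by
      have := norm_add_le (G s (Real.exp (lam * s) • w s) - G s 0) (G s 0)
      simpa [g] using this
    rw [sub_zero, norm_smul, Real.norm_of_nonneg (Real.exp_pos _).le] at h1
    have h3 := w.norm_coe_le_norm s
    have h4 : 1 ≤ Real.exp (lam * s) := Real.one_le_exp (by positivity)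
    have h5 : L * (Real.exp (lam * s) * ‖w s‖) ≤ L * (Real.exp (lam * s) * ‖w‖) := by gcongr
    have h6 := hC s
    nlinarith
  let Phi : BoundedContinuousFunction ℝ Y → BoundedContinuousFunction ℝ Y := fun w =>
    BoundedContinuousFunction.ofNormedAddCommGroup
      (fun t => Real.exp (-(lam * max t 0)) • (v0 + ∫ s in (0:ℝ)..(max t 0), g w s))
      (by
        have h1 : Continuous (fun b : ℝ => ∫ s in (0:ℝ)..b, g w s) :=
          intervalIntegral.continuous_primitive (fun a b => (hgc w).intervalIntegrable a b) 0
        have h2 : Continuous (fun t : ℝ => ∫ s in (0:ℝ)..(max t 0), g w s) :=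
          h1.comp (by fun_prop)
        fun_prop)
      (‖v0‖ + (C + L * ‖w‖) / lam)
      (by
        intro t
        have h0 : 0 ≤ max t 0 := le_max_right _ _
        have := exp_int_bound lam hl (C + L * ‖w‖) (by positivity) (g w) (max t 0) h0 (hgb w)
        rw [norm_smul, Real.norm_of_nonneg (Real.exp_pos _).le]
        have h1 : Real.exp (-(lam * max t 0)) ≤ 1 := by
          apply Real.exp_le_one_iff.2
          nlinarith
        have h2 := norm_add_le v0 (∫ s in (0:ℝ)..(max t 0), g w s)
        have h3 := norm_nonneg v0
        have h4 := Real.exp_pos (-(lam * max t 0))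
        nlinarith)
  have hPhi : ∀ w t, Phi w t =
    Real.exp (-(lam * max t 0)) • (v0 + ∫ s in (0:ℝ)..(max t 0), g w s) := fun _ _ => rfl
  have hcon : ContractingWith (1/2) Phi := by
    constructor
    · rw [← NNReal.coe_lt_coe]; norm_num
    · apply LipschitzWith.of_dist_le_mul
      intro w1 w2
      rw [BoundedContinuousFunction.dist_le (by positivity)]
      intro t
      rw [dist_eq_norm, hPhi, hPhi, ← smul_sub, add_sub_add_left_eq_sub,
        ← intervalIntegral.integral_sub ((hgc w1).intervalIntegrable _ _)
          ((hgc w2).intervalIntegrable _ _), norm_smul, Real.norm_of_nonneg (Real.exp_pos _).le]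
      refine (exp_int_bound lam hl (L * dist w1 w2) (by positivity) _ (max t 0)
        (le_max_right _ _) ?_).trans ?_
      · intro s hs
        refine (hL _ _ _).trans ?_
        rw [← smul_sub, norm_smul, Real.norm_of_nonneg (Real.exp_pos _).le, ← dist_eq_norm]
        have := BoundedContinuousFunction.dist_coe_le_dist (f := w1) (g := w2) s
        have h5 : L * (Real.exp (lam * s) * dist (w1 s) (w2 s)) ≤
          L * (Real.exp (lam * s) * dist w1 w2) := by gcongr
        linarith
      · rw [div_le_iff₀ hl]
        have : 0 ≤ dist w1 w2 := dist_nonneg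
        push_cast
        nlinarith
  obtain ⟨w, hw⟩ : ∃ w, Phi w = w := ⟨_, hcon.fixedPoint_isFixedPt⟩
  have hv : ∀ t, 0 ≤ t → Real.exp (lam * t) • w t =
      v0 + ∫ s in (0:ℝ)..t, G s (Real.exp (lam * s) • w s) := by
    intro t ht
    conv_lhs => rw [← hw, hPhi, max_eq_left ht, smul_smul, ← Real.exp_add]
    simp [g]
  refine ⟨fun t => Real.exp (lam * t) • w t, by fun_prop, ?_, ?_⟩
  · simpa using hv 0 le_rfl
  · intro t ht
    have h1 : HasDerivAt (fun t => v0 + ∫ s in (0:ℝ)..t, g w s) (g w t) t :=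
      (intervalIntegral.integral_hasDerivAt_right ((hgc w).intervalIntegrable _ _)
        ((hgc w).stronglyMeasurableAtFilter _ _) (hgc w).continuousAt).const_add _
    apply h1.congr_of_eventuallyEq
    filter_upwards [lt_mem_nhds ht] with s hs using hv s hs.le

section kernelLemmas
variable {N : ℕ}

lemma conv_int {κ : Euc N → ℝ} (hκ : KernelHyp κ) {u : Euc N → ℝ} (hu : Continuous u) (x : Euc N) :
    Integrable (fun y => κ (y - x) * u y) := by
  apply Continuous.integrable_of_hasCompactSupport
  · exact (hκ.1.comp (by fun_prop)).mul hu
  · apply HasCompactSupport.mul_right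
    exact hκ.2.2.1.comp_homeomorph (Homeomorph.subRight x)

lemma kern_int {κ : Euc N → ℝ} (hκ : KernelHyp κ) (x : Euc N) :
    ∫ y, κ (y - x) = 1 := by
  rw [integral_sub_right_eq_self]; exact hκ.2.2.2.2

lemma kern_integrable {κ : Euc N → ℝ} (hκ : KernelHyp κ) (x : Euc N) :
    Integrable (fun y => κ (y - x)) := by
  simpa using conv_int hκ (u := fun _ => 1) continuous_const x

lemma conv_ge {κ : Euc N → ℝ} (hκ : KernelHyp κ) {u : Euc N → ℝ} (hu : Continuous u) (x : Euc N)
    (b : ℝ) (hb : ∀ y, b ≤ u y) : b ≤ ∫ y, κ (y - x) * u y := by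
  have : ∫ y, κ (y - x) * b ≤ ∫ y, κ (y - x) * u y := by
    apply integral_mono ((kern_integrable hκ x).mul_const b) (conv_int hκ hu x)
    intro y
    exact mul_le_mul_of_nonneg_left (hb y) (hκ.2.1 _)
  rwa [integral_mul_const, kern_int hκ, one_mul] at this

lemma conv_abs {κ : Euc N → ℝ} (hκ : KernelHyp κ) {u : Euc N → ℝ} (hu : Continuous u) (x : Euc N)
    (b : ℝ) (hb : ∀ y, |u y| ≤ b) : |∫ y, κ (y - x) * u y| ≤ b := by
  rw [abs_le]
  refine ⟨conv_ge hκ hu x _ fun y => (abs_le.1 (hb y)).1, ?_⟩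
  have := conv_ge hκ (u := fun y => -u y) hu.neg x (-b) fun y => neg_le_neg (abs_le.1 (hb y)).2
  simp only [mul_neg, integral_neg] at this
  linarith

lemma conv_sub {κ : Euc N → ℝ} (hκ : KernelHyp κ) {u v : Euc N → ℝ} (hu : Continuous u)
    (hv : Continuous v) (x : Euc N) :
    ∫ y, κ (y - x) * (u y - v y) = (∫ y, κ (y - x) * u y) - ∫ y, κ (y - x) * v y := by
  rw [← integral_sub (conv_int hκ hu x) (conv_int hκ hv x)]
  simp only [mul_sub]

lemma conv_shift (κ : Euc N → ℝ) (u : Euc N → ℝ) (x : Euc N) :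
    ∫ y, κ (y - x) * u y = ∫ z, κ (z - 0) * u (z + x) := by
  rw [← integral_add_right_eq_self (fun y => κ (y - x) * u y) x]
  simp

lemma conv_uc {κ : Euc N → ℝ} (hκ : KernelHyp κ) {u : Euc N → ℝ} (hu : UniformContinuous u) :
    UniformContinuous fun x => ∫ y, κ (y - x) * u y := by
  rw [Metric.uniformContinuous_iff] at hu ⊢
  intro ε hε
  obtain ⟨δ, hδ, h⟩ := hu (ε/2) (by positivity)
  refine ⟨δ, hδ, fun {a b} hab => ?_⟩
  have hc : Continuous u := (Metric.uniformContinuous_iff.2 hu).continuous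
  rw [conv_shift κ u a, conv_shift κ u b, Real.dist_eq, ← conv_sub hκ (u := fun z => u (z + a))
    (v := fun z => u (z + b)) (by fun_prop) (by fun_prop)]
  refine (conv_abs hκ (by fun_prop) 0 (ε/2) ?_).trans_lt (by linarith)
  intro z
  rw [← Real.dist_eq]
  exact (h (by simpa using hab)).le

/-- Comparison principle. -/
lemma comparison {κ : Euc N → ℝ} (hκ : KernelHyp κ) (w w' : ℝ → Euc N → ℝ) (t1 : ℝ)
    (hx : ∀ t ∈ Icc 0 t1, Continuous (w t))
    (ht : ∀ x, ContinuousOn (fun t => w t x) (Icc 0 t1))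
    (M : ℝ) (hM : ∀ t ∈ Icc 0 t1, ∀ x, |w t x| ≤ M)
    (hd : ∀ x, ∀ t ∈ Ioo 0 t1, HasDerivAt (fun s => w s x) (w' t x) t)
    (C : ℝ) (hC : 0 ≤ C)
    (hw : ∀ x, ∀ t ∈ Ioo 0 t1, (∫ y, κ (y - x) * w t y) - C * |w t x| ≤ w' t x)
    (h0 : ∀ x, 0 ≤ w 0 x) : ∀ t ∈ Icc 0 t1, ∀ x, 0 ≤ w t x := by
  intro t htt
  have ht1 : 0 ≤ t1 := htt.1.trans htt.2
  set L : ℝ := 1 + 2 * C with hL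
  set B : ℝ := Real.exp (C * t1) * M with hB
  have hM0 : 0 ≤ M := (abs_nonneg _).trans (hM 0 ⟨le_rfl, ht1⟩ 0)
  have hB0 : 0 ≤ B := by positivity
  have key : ∀ n : ℕ, ∀ t ∈ Icc 0 t1, ∀ x,
      -(B * ((L * t) ^ n / n.factorial)) ≤ Real.exp (C * t) * w t x := by
    intro n
    induction n with
    | zero =>
      intro t ht x
      have h1 := (abs_le.1 (hM t ht x)).1
      have h2 : Real.exp (C * t) ≤ Real.exp (C * t1) := by
        apply Real.exp_le_exp.2
        exact mul_le_mul_of_nonneg_left ht.2 hC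
      have h3 := Real.exp_pos (C * t)
      simp only [pow_zero, Nat.factorial_zero, Nat.cast_one, div_one, mul_one]
      have : Real.exp (C * t) * M ≤ B := by rw [hB]; gcongr
      nlinarith
    | succ n ih =>
      intro t htm x
      let F : ℝ → ℝ := fun s => Real.exp (C * s) * w s x + B * ((L * s) ^ (n+1) / (n+1).factorial)
      have hFc : ContinuousOn F (Icc 0 t1) := by
        apply ContinuousOn.add
        · apply ContinuousOn.mul (by fun_prop) (ht x)
        · fun_prop
      have hFd : ∀ s ∈ Ioo 0 t1, HasDerivAt F
          (Real.exp (C * s) * (C * w s x + w' s x) + B * (L * ((L * s) ^ n / n.factorial))) s := by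
        intro s hs
        have e1 : HasDerivAt (fun s => Real.exp (C * s)) (Real.exp (C * s) * (C * 1)) s :=
          ((hasDerivAt_id s).const_mul C).exp
        have e2 : HasDerivAt (fun s => B * ((L * s) ^ (n+1) / (n+1).factorial))
            (B * ((((n+1 : ℕ) : ℝ) * (L * s) ^ n * (L * 1)) / (n+1).factorial)) s := by
          have := ((((hasDerivAt_id s).const_mul L).pow (n+1)).div_const
            ((n+1).factorial : ℝ)).const_mul B
          simpa using this
        refine ((e1.mul (hd x s hs)).add e2).congr_deriv ?_
        rw [Nat.factorial_succ]
        push_cast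
        field_simp
      have hmono : MonotoneOn F (Icc 0 t1) := by
        apply monotoneOn_of_deriv_nonneg (convex_Icc 0 t1) hFc
        · intro s hs
          rw [interior_Icc] at hs
          exact (hFd s hs).differentiableAt.differentiableWithinAt
        · intro s hs
          rw [interior_Icc] at hs
          rw [(hFd s hs).deriv]
          have hs' : s ∈ Icc 0 t1 := ⟨hs.1.le, hs.2.le⟩
          set β := B * ((L * s) ^ n / n.factorial) with hβ
          have hE := Real.exp_pos (C * s)
          have i1 : -β ≤ ∫ y, κ (y - x) * (Real.exp (C * s) * w s y) :=
            conv_ge hκ (continuous_const.mul (hx s hs')) x _ (ih s hs')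
          have i2 : ∫ y, κ (y - x) * (Real.exp (C * s) * w s y) =
              Real.exp (C * s) * ∫ y, κ (y - x) * w s y := by
            rw [← integral_const_mul]; congr 1; ext y; ring
          have i3 := ih s hs' x
          have i4 := mul_le_mul_of_nonneg_left (hw x s hs) hE.le
          have hβ0 : 0 ≤ β := by
            have := hs.1
            positivity
          have i5 : Real.exp (C * s) * w s x - Real.exp (C * s) * |w s x| ≥ -(2 * β) := by
            rcases abs_cases (w s x) with ⟨h, _⟩ | ⟨h, _⟩ <;> rw [h] <;> linarith
          have i6 := mul_le_mul_of_nonneg_left i5 hC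
          have : B * (L * ((L * s) ^ n / n.factorial)) = β + 2 * C * β := by rw [hβ, hL]; ring
          rw [this]
          rw [i2] at i1
          nlinarith
      have h1 := hmono ⟨le_rfl, ht1⟩ htm htm.1
      have h2 : F 0 = w 0 x := by simp [F]
      rw [h2] at h1
      have h3 := h0 x
      simp only [F] at h1
      linarith
  intro x
  have hlim : Tendsto (fun n : ℕ => -(B * ((L * t) ^ n / n.factorial))) atTop (nhds (-(B * 0))) :=
    ((FloorSemiring.tendsto_pow_div_factorial_atTop (L * t)).const_mul B).neg
  have h4 : -(B * 0) ≤ Real.exp (C * t) * w t x :=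
    le_of_tendsto' hlim (fun n => key n t htt x)
  simp only [mul_zero, neg_zero] at h4
  exact nonneg_of_mul_nonneg_right h4 (Real.exp_pos _)

lemma reac_lip {T M₀ : ℝ} {f : ℝ → Euc N → ℝ → ℝ} (hf : SatH0 T M₀ f) (R : ℝ) (hR : 0 < R) :
    ∃ L, 0 ≤ L ∧ ∀ t x p q, |p| ≤ R → |q| ≤ R → |p * f t x p - q * f t x q| ≤ L * |p - q| := by
  obtain ⟨C, hC⟩ := (hf.2.2.1 R hR).1
  have hC0 : 0 ≤ C := le_trans (by positivity) (hC 0 0 0 (by simpa using hR.le))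
  refine ⟨C + R * C, by positivity, ?_⟩
  intro t x p q hp hq
  have hdiff : Differentiable ℝ (fun v => f t x v) := by
    have h1 : ContDiff ℝ 1 (fun v : ℝ => f t x v) :=
      (hf.2.1 x).comp (f := fun v : ℝ => (t, v)) (by fun_prop)
    exact h1.differentiable one_ne_zero
  have := (convex_Icc (-R) R).norm_image_sub_le_of_norm_hasDerivWithin_le
    (f := fun v => v * f t x v) (f' := fun v => 1 * f t x v + v * deriv (fun v => f t x v) v)
    (C := C + R * C) (x := q) (y := p) (fun v hv =>
      ((hasDerivAt_id v).mul (hdiff v).hasDerivAt).hasDerivWithinAt) (fun v hv => by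
      have hv' : |v| ≤ R := abs_le.2 hv
      have h := hC t x v hv'
      have a1 := abs_nonneg (f t x v)
      have a2 := abs_nonneg (deriv (fun s => f s x v) t)
      have a3 := abs_nonneg (deriv (fun v => f t x v) v)
      have h2 : |v| * |deriv (fun v => f t x v) v| ≤ R * C := by
        apply mul_le_mul hv' (by linarith) a3 hR.le
      calc ‖1 * f t x v + v * deriv (fun v => f t x v) v‖
        _ ≤ |f t x v| + |v| * |deriv (fun v => f t x v) v| := by
          rw [one_mul, ← abs_mul]; exact abs_add_le _ _
        _ ≤ _ := by linarith) (abs_le.1 hq) (abs_le.1 hp)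
  simpa [Real.norm_eq_abs] using this

lemma time_lip {T M₀ : ℝ} {f : ℝ → Euc N → ℝ → ℝ} (hf : SatH0 T M₀ f) (R : ℝ) (hR : 0 < R) :
    ∃ C, 0 ≤ C ∧ (∀ t x p, |p| ≤ R → |f t x p| ≤ C) ∧
      ∀ t s x p, |p| ≤ R → |f t x p - f s x p| ≤ C * |t - s| := by
  obtain ⟨C, hC⟩ := (hf.2.2.1 R hR).1
  have hC0 : 0 ≤ C := le_trans (by positivity) (hC 0 0 0 (by simpa using hR.le))
  refine ⟨C, hC0, ?_, ?_⟩
  · intro t x p hp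
    have := hC t x p hp
    have a2 := abs_nonneg (deriv (fun s => f s x p) t)
    have a3 := abs_nonneg (deriv (fun v => f t x v) p)
    linarith
  · intro t s x p hp
    have hdiff : Differentiable ℝ (fun r => f r x p) := by
      have h1 : ContDiff ℝ 1 (fun r : ℝ => f r x p) :=
        (hf.2.1 x).comp (f := fun r : ℝ => (r, p)) (by fun_prop)
      exact h1.differentiable one_ne_zero
    have := convex_univ.norm_image_sub_le_of_norm_deriv_le (f := fun r => f r x p) (C := C)
      (x := s) (y := t) (fun r _ => hdiff r) (fun r _ => by
        have := hC r x p hp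
        have a2 := abs_nonneg (f r x p)
        have a3 := abs_nonneg (deriv (fun v => f r x v) p)
        rw [Real.norm_eq_abs]
        linarith) (mem_univ _) (mem_univ _)
    simpa [Real.norm_eq_abs] using this

end kernelLemmas

section existence
variable {N : ℕ}

/-- The space of bounded uniformly continuous functions. -/
def BUC (N : ℕ) : Submodule ℝ (BoundedContinuousFunction (Euc N) ℝ) where
  carrier := {u | UniformContinuous u}
  add_mem' := fun {a b} ha hb => UniformContinuous.add (f := a) (g := b) ha hb
  zero_mem' := uniformContinuous_const
  smul_mem' := fun r a ha => UniformContinuous.const_smul (f := a) ha r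

lemma BUC_closed (N : ℕ) : IsClosed (BUC N : Set (BoundedContinuousFunction (Euc N) ℝ)) := by
  apply IsSeqClosed.isClosed
  intro F g hF hg
  exact (BoundedContinuousFunction.tendsto_iff_tendstoUniformly.1 hg).uniformContinuous
    (Eventually.of_forall hF).frequently

instance (N : ℕ) : CompleteSpace (BUC N) := (BUC_closed N).completeSpace_coe

def mkY (u : Euc N → ℝ) (h : MemX u) : BUC N :=
  ⟨BoundedContinuousFunction.ofNormedAddCommGroup u h.1.continuous h.2.choose h.2.choose_spec, h.1⟩

lemma mkY_apply (u : Euc N → ℝ) (h : MemX u) (x : Euc N) : (mkY u h).1 x = u x := rfl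

lemma BUC_norm_le (u : BUC N) (C : ℝ) (hC : 0 ≤ C) (h : ∀ x, |u.1 x| ≤ C) : ‖u‖ ≤ C :=
  (BoundedContinuousFunction.norm_le hC).2 h

lemma BUC_le_norm (u : BUC N) (x : Euc N) : |u.1 x| ≤ ‖u‖ := u.1.norm_coe_le_norm x

lemma BUC_memX (u : BUC N) : MemX (fun x => u.1 x) := ⟨u.2, _, BUC_le_norm u⟩

def clampK (K r : ℝ) : ℝ := max 0 (min r K)

lemma clampK_abs_le {K : ℝ} (hK : 0 < K) (r : ℝ) : |clampK K r| ≤ K := by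
  unfold clampK
  rw [abs_of_nonneg (le_max_left _ _)]
  exact max_le hK.le (min_le_right _ _)

lemma clampK_lip (K a b : ℝ) : |clampK K a - clampK K b| ≤ |a - b| := by
  unfold clampK
  calc _ ≤ |min a K - min b K| := by
        rw [max_comm 0, max_comm 0]; exact abs_max_sub_max_le_abs _ _ _
    _ ≤ _ := by
      have := abs_min_sub_min_le_max a K b K
      simpa using this

lemma clampK_uc (K : ℝ) : UniformContinuous (clampK K) := by
  have : LipschitzWith 1 (clampK K) := by
    apply LipschitzWith.of_dist_le_mul
    intro a b
    simpa [Real.dist_eq] using clampK_lip K a b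
  exact this.uniformContinuous

lemma clampK_le_abs {K : ℝ} (hK : 0 < K) (r : ℝ) : |clampK K r| ≤ |r| := by
  have := clampK_lip K r 0
  have h0 : clampK K 0 = 0 := by simp [clampK, hK.le]
  simpa [h0] using this

lemma clampK_eq {K r : ℝ} (h0 : 0 ≤ r) (h1 : r ≤ K) : clampK K r = r := by
  simp [clampK, h0, h1]

lemma clampK_ge {K r : ℝ} (hK : 0 < K) (h1 : K ≤ r) : clampK K r = K := by
  simp [clampK, h1, hK.le]

/-- Truncated right-hand side. -/
def TR (κ : Euc N → ℝ) (f : ℝ → Euc N → ℝ → ℝ) (K t : ℝ) (u : Euc N → ℝ) (x : Euc N) : ℝ :=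
  (∫ y, κ (y - x) * u y) - u x + clampK K (u x) * f t x (clampK K (u x))

lemma bdd_mul_uc {a b : Euc N → ℝ} (ha : MemX a) (hb : MemX b) : MemX (fun x => a x * b x) := by
  obtain ⟨ha, A, hA⟩ := ha
  obtain ⟨hb, B, hB⟩ := hb
  have hA0 : 0 ≤ A := (abs_nonneg _).trans (hA 0)
  have hB0 : 0 ≤ B := (abs_nonneg _).trans (hB 0)
  refine ⟨?_, A * B, fun x => by
    rw [abs_mul]; exact mul_le_mul (hA x) (hB x) (abs_nonneg _) hA0⟩
  rw [Metric.uniformContinuous_iff] at ha hb ⊢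
  intro ε hε
  obtain ⟨d1, hd1, h1⟩ := ha (ε / (2 * (B + 1))) (by positivity)
  obtain ⟨d2, hd2, h2⟩ := hb (ε / (2 * (A + 1))) (by positivity)
  refine ⟨min d1 d2, lt_min hd1 hd2, fun {x y} hxy => ?_⟩
  have e1 := h1 (hxy.trans_le (min_le_left _ _))
  have e2 := h2 (hxy.trans_le (min_le_right _ _))
  rw [Real.dist_eq] at *
  rw [lt_div_iff₀ (by positivity)] at e1 e2
  have : a x * b x - a y * b y = (a x - a y) * b x + a y * (b x - b y) := by ring
  rw [this]
  have e3 := abs_add_le ((a x - a y) * b x) (a y * (b x - b y))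
  rw [abs_mul, abs_mul] at e3
  have e4 : |a x - a y| * |b x| ≤ |a x - a y| * B := by gcongr; exact hB x
  have e5 : |a y| * |b x - b y| ≤ A * |b x - b y| := by gcongr; exact hA y
  nlinarith [abs_nonneg (a x - a y), abs_nonneg (b x - b y)]

lemma TR_memX {κ : Euc N → ℝ} (hκ : KernelHyp κ) {T M₀ : ℝ} {f : ℝ → Euc N → ℝ → ℝ}
    (hf : SatH0 T M₀ f) {K : ℝ} (hK : 0 < K) (t : ℝ) {u : Euc N → ℝ} (hu : MemX u) :
    MemX (TR κ f K t u) := by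
  obtain ⟨C, hC0, hC, -⟩ := time_lip hf K hK
  have huc := hu.1
  have hcl : UniformContinuous (fun x => clampK K (u x)) := (clampK_uc K).comp hu.1
  have h1 : MemX (fun x => clampK K (u x)) := ⟨hcl, K, fun x => clampK_abs_le hK _⟩
  have h2 : MemX (fun x => f t x (clampK K (u x))) := by
    refine ⟨?_, C, fun x => hC _ _ _ (clampK_abs_le hK _)⟩
    have h := (hf.2.2.1 K hK).2.1
    have hm : UniformContinuous (fun x : Euc N => (t, x, clampK K (u x))) :=
      uniformContinuous_const.prodMk (uniformContinuous_id.prodMk hcl)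
    rw [← uniformContinuousOn_univ] at hm ⊢
    exact h.comp hm (fun x _ => clampK_abs_le hK _)
  have h3 := bdd_mul_uc h1 h2
  obtain ⟨h4, B, hB⟩ := h3
  obtain ⟨hu1, A, hA⟩ := hu
  refine ⟨((conv_uc hκ hu1).sub hu1).add h4, A + A + B, fun x => ?_⟩
  have e1 := conv_abs hκ hu1.continuous x A hA
  have e2 := hA x
  have e3 := hB x
  unfold TR
  rw [abs_le] at *
  constructor <;> linarith

lemma TR_lip {κ : Euc N → ℝ} (hκ : KernelHyp κ) {T M₀ : ℝ} {f : ℝ → Euc N → ℝ → ℝ}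
    (hf : SatH0 T M₀ f) {K : ℝ} (hK : 0 < K) : ∃ L, 0 ≤ L ∧ ∀ t (u v : Euc N → ℝ),
      Continuous u → Continuous v → ∀ d, (∀ x, |u x - v x| ≤ d) → ∀ x,
      |TR κ f K t u x - TR κ f K t v x| ≤ L * d := by
  obtain ⟨L, hL0, hL⟩ := reac_lip hf K hK
  refine ⟨2 + L, by positivity, fun t u v hu hv d hd x => ?_⟩
  have e1 := conv_abs hκ (u := fun y => u y - v y) (hu.sub hv) x d hd
  rw [conv_sub hκ hu hv] at e1
  have e2 := hL t x _ _ (clampK_abs_le hK (u x)) (clampK_abs_le hK (v x))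
  have e3 : L * |clampK K (u x) - clampK K (v x)| ≤ L * d := by
    gcongr
    exact (clampK_lip K _ _).trans (hd x)
  have e4 := e2.trans e3
  have e5 := hd x
  unfold TR
  rw [abs_le] at e1 e4 e5 ⊢
  constructor <;> linarith

lemma trunc_exists {κ : Euc N → ℝ} (hκ : KernelHyp κ) {T M₀ : ℝ} {f : ℝ → Euc N → ℝ → ℝ}
    (hf : SatH0 T M₀ f) {K : ℝ} (hK : 0 < K) {v₀ : Euc N → ℝ} (hv₀ : MemX v₀) :
    ∃ v : ℝ → BUC N, Continuous v ∧ (∀ x, (v 0).1 x = v₀ x) ∧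
      ∀ t > 0, ∀ x, HasDerivAt (fun s => (v s).1 x) (TR κ f K t (fun y => (v t).1 y) x) t := by
  obtain ⟨L, hL0, hL⟩ := TR_lip hκ hf hK
  obtain ⟨C, hC0, hC, hC2⟩ := time_lip hf K hK
  let G : ℝ → BUC N → BUC N := fun t u => mkY _ (TR_memX hκ hf hK t (BUC_memX u))
  have hGa : ∀ t u x, (G t u).1 x = TR κ f K t (fun y => u.1 y) x := fun _ _ _ => rfl
  obtain ⟨v, hv1, hv2, hv3⟩ := global_ode G L hL0 (by
      intro t y z
      refine BUC_norm_le _ _ (by positivity) fun x => ?_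
      exact hL t (fun a => y.1 a) (fun a => z.1 a) y.1.continuous z.1.continuous ‖y - z‖
        (fun a => BUC_le_norm (y - z) a) x)
    0 (by
      intro t
      refine BUC_norm_le _ _ le_rfl fun x => ?_
      rw [hGa]
      simp [TR, clampK, hK.le])
    (by
      intro y
      have : LipschitzWith ⟨K * C, by positivity⟩ (fun t => G t y) := by
        apply LipschitzWith.of_dist_le_mul
        intro t s
        rw [Real.dist_eq, dist_eq_norm (G t y) (G s y)]
        change ‖G t y - G s y‖ ≤ K * C * |t - s|
        refine BUC_norm_le _ _ (by positivity) fun x => ?_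
        change |TR κ f K t (fun a => y.1 a) x - TR κ f K s (fun a => y.1 a) x| ≤ K * C * |t - s|
        unfold TR
        rw [add_sub_add_left_eq_sub, ← mul_sub, abs_mul, mul_assoc]
        exact mul_le_mul (clampK_abs_le hK _) (hC2 _ _ _ _ (clampK_abs_le hK _))
          (abs_nonneg _) hK.le
      exact this.continuous)
    (mkY v₀ hv₀)
  refine ⟨v, hv1, fun x => by rw [hv2]; rfl, fun t ht x => ?_⟩
  let ev : BUC N →L[ℝ] ℝ := (BoundedContinuousFunction.evalCLM ℝ x).comp (BUC N).subtypeL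
  exact ev.hasFDerivAt.comp_hasDerivAt t (hv3 t ht)

lemma sol_exists {κ : Euc N → ℝ} (hκ : KernelHyp κ) {T M₀ : ℝ} (hM₀ : 0 < M₀)
    {f : ℝ → Euc N → ℝ → ℝ}
    (hf : SatH0 T M₀ f) {v₀ : Euc N → ℝ} (hv₀ : MemX v₀) (hpos : ∀ x, 0 ≤ v₀ x) :
    ∃ v : ℝ → Euc N → ℝ, IsSol κ f v (Ici 0) ∧ (∀ x, v 0 x = v₀ x) := by
  obtain ⟨A, hA⟩ := hv₀.2
  set K := max M₀ A with hKd
  have hK : 0 < K := lt_max_of_lt_left hM₀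
  obtain ⟨v, hvc, hv0, hvd⟩ := trunc_exists hκ hf hK hv₀
  obtain ⟨C, hC0, hC, hC2⟩ := time_lip hf K hK
  obtain ⟨L, hL0, hL⟩ := reac_lip hf K hK
  have hjc : Continuous (fun p : ℝ × Euc N => (v p.1).1 p.2) := by
    have h1 : Continuous (fun p : ℝ × Euc N => (v p.1).1) :=
      continuous_subtype_val.comp (hvc.comp continuous_fst)
    exact h1.eval continuous_snd
  have hx : ∀ t, Continuous (fun x => (v t).1 x) := fun t => (v t).1.continuous
  have ht : ∀ x, Continuous (fun t => (v t).1 x) := fun x =>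
    hjc.comp (f := fun t => (t, x)) (by fun_prop)
  have hbd : ∀ J : Set ℝ, IsCompact J → ∃ B, ∀ t ∈ J, ∀ x, |(v t).1 x| ≤ B := by
    intro J hJ
    obtain ⟨B, hB⟩ := hJ.exists_bound_of_continuousOn (f := fun t => (v t).1)
      (continuous_subtype_val.comp hvc).continuousOn
    exact ⟨B, fun t htJ x => (BUC_le_norm _ x).trans (hB t htJ)⟩
  have hnn : ∀ t ≥ 0, ∀ x, 0 ≤ (v t).1 x := by
    intro t1 ht1
    obtain ⟨B, hB⟩ := hbd (Icc 0 t1) isCompact_Icc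
    refine comparison hκ (fun t x => (v t).1 x) (fun t x => TR κ f K t (fun y => (v t).1 y) x) t1
      (fun t _ => hx t) (fun x => (ht x).continuousOn) B hB (fun x t h => hvd t h.1 x)
      (1 + C) (by positivity) ?_ (fun x => by simpa [hv0] using hpos x) t1 ⟨ht1, le_rfl⟩
    intro x t h
    simp only [TR]
    have e1 := mul_le_mul (clampK_le_abs hK ((v t).1 x))
      (hC t x _ (clampK_abs_le hK ((v t).1 x))) (abs_nonneg _) (abs_nonneg _)
    rw [← abs_mul] at e1
    have e2 := (abs_le.1 e1).1
    have e3 := le_abs_self ((v t).1 x)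
    nlinarith
  have hle : ∀ t ≥ 0, ∀ x, 0 ≤ K - (v t).1 x := by
    intro t1 ht1
    obtain ⟨B, hB⟩ := hbd (Icc 0 t1) isCompact_Icc
    refine comparison hκ (fun t x => K - (v t).1 x)
      (fun t x => -TR κ f K t (fun y => (v t).1 y) x) t1
      (fun t _ => continuous_const.sub (hx t))
      (fun x => (continuous_const.sub (ht x)).continuousOn) (K + B)
      (fun t h x => ?_) (fun x t h => (hvd t h.1 x).const_sub K)
      (1 + L) (by positivity) ?_ (fun x => ?_) t1 ⟨ht1, le_rfl⟩
    · have := hB t h x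
      rw [abs_le] at *
      constructor <;> linarith
    · intro x t h
      rw [conv_sub hκ continuous_const (hx t), integral_mul_const, kern_int hκ, one_mul]
      simp only [TR]
      have e1 := hL t x (clampK K ((v t).1 x)) (clampK K K) (clampK_abs_le hK _)
        (clampK_abs_le hK _)
      have e2 : L * |clampK K ((v t).1 x) - clampK K K| ≤ L * |K - (v t).1 x| := by
        apply mul_le_mul_of_nonneg_left _ hL0
        rw [abs_sub_comm K]
        exact clampK_lip _ _ _
      have e3 := (abs_le.1 (e1.trans e2)).2
      rw [clampK_ge hK le_rfl] at e3
      have e4 : K * f t x K ≤ 0 :=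
        mul_nonpos_of_nonneg_of_nonpos hK.le (hf.2.2.2.1 t x K (le_max_left _ _)).le
      have e5 := le_abs_self (K - (v t).1 x)
      nlinarith
    · have := (abs_le.1 (hA x)).2
      have h2 := le_max_right M₀ A
      rw [hv0]
      linarith
  refine ⟨fun t x => (v t).1 x, ⟨hjc.continuousOn, fun t _ => BUC_memX _,
    fun J _ hJ => hbd J hJ, fun x t h => ?_⟩, hv0⟩
  rw [interior_Ici] at h
  have h0 : 0 < t := h
  have := hvd t h0 x
  have hcl : clampK K ((v t).1 x) = (v t).1 x :=
    clampK_eq (hnn t h0.le x) (by linarith [hle t h0.le x])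
  simpa only [TR, RHS, hcl] using this

lemma sol_compare {κ : Euc N → ℝ} (hκ : KernelHyp κ) {T M₀ : ℝ}
    {f : ℝ → Euc N → ℝ → ℝ} (hf : SatH0 T M₀ f) {u v : ℝ → Euc N → ℝ}
    (hu : IsSol κ f u (Ici 0)) (hv : IsSol κ f v (Ici 0)) (h0 : ∀ x, u 0 x ≤ v 0 x) :
    ∀ t ≥ 0, ∀ x, u t x ≤ v t x := by
  intro t1 ht1 x1
  have hsub : Icc 0 t1 ⊆ Ici (0:ℝ) := fun s hs => hs.1
  obtain ⟨A, hA⟩ := hu.2.2.1 _ hsub isCompact_Icc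
  obtain ⟨B, hB⟩ := hv.2.2.1 _ hsub isCompact_Icc
  have hct : ∀ {w : ℝ → Euc N → ℝ}, IsSol κ f w (Ici 0) → ∀ x,
      ContinuousOn (fun t => w t x) (Icc 0 t1) := by
    intro w hw x
    exact hw.1.comp (f := fun t : ℝ => (t, x)) (by fun_prop) (fun s hs => ⟨hs.1, mem_univ _⟩)
  have hcx : ∀ {w : ℝ → Euc N → ℝ}, IsSol κ f w (Ici 0) → ∀ t ∈ Icc 0 t1,
      Continuous (w t) := fun hw t h => (hw.2.1 t h.1).1.continuous
  have hA0 : 0 ≤ A := (abs_nonneg _).trans (hA 0 ⟨le_rfl, ht1⟩ 0)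
  have hB0 : 0 ≤ B := (abs_nonneg _).trans (hB 0 ⟨le_rfl, ht1⟩ 0)
  obtain ⟨L, hL0, hL⟩ := reac_lip hf (A + B + 1) (by positivity)
  have := comparison hκ (fun t x => v t x - u t x) (fun t x => RHS κ f v t x - RHS κ f u t x) t1
    (fun t h => (hcx hv t h).sub (hcx hu t h)) (fun x => (hct hv x).sub (hct hu x)) (A + B)
    (fun t h x => by
      have := hA t h x
      have := hB t h x
      rw [abs_le] at *
      constructor <;> linarith)
    (fun x t h => (hv.2.2.2 x t (by rw [interior_Ici]; exact h.1)).sub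
      (hu.2.2.2 x t (by rw [interior_Ici]; exact h.1)))
    (1 + L) (by positivity) (fun x t h => by
      have h' : t ∈ Icc 0 t1 := ⟨h.1.le, h.2.le⟩
      rw [conv_sub hκ (hcx hv t h') (hcx hu t h')]
      have a1 := hA t h' x
      have a2 := hB t h' x
      have e1 := (abs_le.1 (hL t x (v t x) (u t x) (by linarith) (by linarith))).1
      have e2 := le_abs_self (v t x - u t x)
      simp only [RHS]
      nlinarith)
    (fun x => by linarith [h0 x]) t1 ⟨ht1, le_rfl⟩ x1
  linarith

lemma front_exists (ξ : Euc N) (hξ : ‖ξ‖ = 1) {u₀ : Euc N → ℝ} (hu : MemX u₀)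
    (hsupp : ∃ r₀ : ℝ, ∀ x : Euc N, r₀ ≤ ‖x‖ → u₀ x = 0) :
    ∃ v₀, XplusXi ξ v₀ ∧ ∀ x, u₀ x ≤ v₀ x := by
  obtain ⟨-, A, hA⟩ := hu
  obtain ⟨r, hr⟩ := hsupp
  have hA0 : 0 ≤ A := (abs_nonneg _).trans (hA 0)
  have hin : UniformContinuous (fun x : Euc N => r + (A + 1) - ⟪x, ξ⟫) := by
    have : LipschitzWith 1 (fun x : Euc N => r + (A + 1) - ⟪x, ξ⟫) := by
      apply LipschitzWith.of_dist_le_mul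
      intro x y
      rw [Real.dist_eq, dist_eq_norm, abs_sub_comm]
      have : r + (A + 1) - ⟪y, ξ⟫ - (r + (A + 1) - ⟪x, ξ⟫) = ⟪x - y, ξ⟫ := by
        rw [inner_sub_left]; ring
      rw [this]
      have := abs_real_inner_le_norm (x - y) ξ
      simpa [hξ] using this
    exact this.uniformContinuous
  refine ⟨fun x => clampK (A + 1) (r + (A + 1) - ⟪x, ξ⟫), ⟨⟨(clampK_uc _).comp hin, A + 1,
    fun x => clampK_abs_le (by positivity) _⟩, fun x => le_max_left _ _,
    ⟨A + 1, by positivity, r, fun x hx => ?_⟩, ⟨r + (A + 1), fun x hx => ?_⟩⟩, fun x => ?_⟩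
  · exact (clampK_ge (K := A + 1) (by positivity) (by linarith)).ge
  · unfold clampK
    exact max_eq_left ((min_le_left _ _).trans (by linarith))
  · rcases le_or_gt r ‖x‖ with h | h
    · rw [hr x h]; exact le_max_left _ _
    · have h1 : ⟪x, ξ⟫ ≤ ‖x‖ := by simpa [hξ] using real_inner_le_norm x ξ
      have h2 := clampK_ge (K := A + 1) (r := r + (A + 1) - ⟪x, ξ⟫) (by positivity) (by linarith)
      simp only [h2]
      linarith [(abs_le.1 (hA x)).2]

end existence

/-- radial upper spreading bound from directional bounds. -/
theorem stmt19 {N : ℕ} (hN : 1 ≤ N) (T M₀ : ℝ) (hT : 0 < T) (hM₀ : 0 < M₀)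
    (κ : Euc N → ℝ) (hκ : KernelHyp κ)
    (f : ℝ → Euc N → ℝ → ℝ) (hf : SatH0 T M₀ f)
    (c : ℝ) (hc : 0 < c)
    (hdir : ∀ ξ : Euc N, ‖ξ‖ = 1 → ∀ v₀ : Euc N → ℝ, XplusXi ξ v₀ →
      ∀ v : ℝ → Euc N → ℝ, IsSol κ f v (Set.Ici 0) → (∀ x, v 0 x = v₀ x) →
      ∀ ε > (0:ℝ), ∃ t₀ : ℝ, ∀ t ≥ t₀, ∀ x : Euc N, c * t ≤ ⟪x, ξ⟫ → v t x ≤ ε)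
    (u₀ : Euc N → ℝ) (hu₀X : MemX u₀) (hu₀pos : ∀ x, 0 ≤ u₀ x)
    (hsupp : ∃ r₀ : ℝ, ∀ x : Euc N, r₀ ≤ ‖x‖ → u₀ x = 0)
    (u : ℝ → Euc N → ℝ) (hu : IsSol κ f u (Set.Ici 0)) (hu0 : ∀ x, u 0 x = u₀ x) :
    ∀ c' > c, ∀ ε > (0:ℝ), ∃ t₀ : ℝ, ∀ t ≥ t₀, ∀ x : Euc N,
      c' * t ≤ ‖x‖ → u t x ≤ ε := by
  intro c' hc' ε hε
  have hc'0 : 0 < c' := hc.trans hc'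
  have hlt : c / c' < 1 := (div_lt_one hc'0).2 hc'
  obtain ⟨s, hs1, hs2⟩ := (isCompact_sphere (0 : Euc N) 1).elim_nhds_subcover
    (fun ξ => {η : Euc N | c / c' < ⟪η, ξ⟫}) (by
      intro ξ hξ
      have hξ1 : ‖ξ‖ = 1 := by simpa using hξ
      apply IsOpen.mem_nhds
      · exact isOpen_lt continuous_const (by fun_prop)
      · change c / c' < ⟪ξ, ξ⟫
        rw [real_inner_self_eq_norm_sq, hξ1]
        simpa using hlt)
  have hev : ∀ᶠ t in (atTop : Filter ℝ), ∀ ξ ∈ s, ∀ x : Euc N, c * t ≤ ⟪x, ξ⟫ → u t x ≤ ε := by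
    rw [Filter.eventually_all_finset]
    intro ξ hξs
    have hξ1 : ‖ξ‖ = 1 := by simpa using hs1 ξ hξs
    obtain ⟨v₀, hv₀, hle⟩ := front_exists ξ hξ1 hu₀X hsupp
    obtain ⟨v, hv, hv0⟩ := sol_exists hκ hM₀ hf hv₀.1 hv₀.2.1
    obtain ⟨t₀, ht₀⟩ := hdir ξ hξ1 v₀ hv₀ v hv hv0 ε hε
    filter_upwards [eventually_ge_atTop t₀, eventually_ge_atTop 0] with t h1 h2 x hx
    exact (sol_compare hκ hf hu hv (fun x => by rw [hu0, hv0]; exact hle x) t h2 x).trans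
      (ht₀ t h1 x hx)
  obtain ⟨t₀, ht₀⟩ := eventually_atTop.1 (hev.and (eventually_gt_atTop 0))
  refine ⟨t₀, fun t ht x hx => ?_⟩
  obtain ⟨h1, h2⟩ := ht₀ t ht
  have hxpos : 0 < ‖x‖ := (mul_pos hc'0 h2).trans_le hx
  have hmem : (‖x‖⁻¹ • x) ∈ Metric.sphere (0 : Euc N) 1 := by
    simp [norm_smul, hxpos.ne']
  obtain ⟨ξ, hξs, hξ⟩ := mem_iUnion₂.1 (hs2 hmem)
  refine h1 ξ hξs x ?_
  have h3 : c / c' < ⟪‖x‖⁻¹ • x, ξ⟫ := hξ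
  rw [real_inner_smul_left, inv_mul_eq_div, div_lt_div_iff₀ hc'0 hxpos] at h3
  have h4 : c * (c' * t) ≤ c * ‖x‖ := mul_le_mul_of_nonneg_left hx hc.le
  have h5 : c' * (c * t) ≤ c' * ⟪x, ξ⟫ := by linarith
  exact le_of_mul_le_mul_left h5 hc'0

end
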